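/- arXiv:1905.07805 — 2 statements merged into one kernel-verified Lean document; each statement's English description precedes it below -/
import Mathlib

section
/- Let U be a finite type of cardinality n, let t be a natural number with n > 3·t, and let f be a finite subset of U with |f| ≤ t. Then for all finite subsets X, Y of U with |X| + t ≥ n and 2·|Y| ≥ n + 3·t + 1, it holds that 2·|(X ∩ Y) \ f| ≥ n − t + 1, i.e., 2·|(X ∩ Y) \ f| + t ≥ n + 1. -/
theorem bosco_threshold_intersection (U : Type*) [Fintype U] [DecidableEq U]
    (n t : ℕ) (hn : Fintype.card U = n) (ht : n > 3 * t)
    (f : Finset U) (hf : f.card ≤ t) :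
    ∀ X Y : Finset U, X.card + t ≥ n → 2 * Y.card ≥ n + 3 * t + 1 →
      2 * ((X ∩ Y) \ f).card + t ≥ n + 1 := by
  intro X Y hX hY
  have h1 := Finset.card_union_add_card_inter X Y
  have h2 : (X ∪ Y).card ≤ Fintype.card U := Finset.card_le_univ _
  have h3 := Finset.le_card_sdiff f (X ∩ Y)
  omega
end

section
/- Let U be a finite type of cardinality n, let b be a finite subset of U, and let t₁, t₂ be natural numbers with t₁ ≤ n and 1 ≤ t₂. Then the following are equivalent: (i) for every finite subset X of U with |X| ≥ t₁, it holds that |X ∩ b| ≥ t₂; (ii) for every natural number u with t₁ ≤ u ≤ n, it holds that t₂ + n ≤ u + |b|. -/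
theorem tip_set_to_int_quantifier (U : Type*) [Fintype U] [DecidableEq U]
    (n : ℕ) (hn : Fintype.card U = n) (b : Finset U)
    (t₁ t₂ : ℕ) (ht₁ : t₁ ≤ n) (ht₂ : 1 ≤ t₂) :
    (∀ X : Finset U, X.card ≥ t₁ → (X ∩ b).card ≥ t₂) ↔
      (∀ u : ℕ, t₁ ≤ u → u ≤ n → t₂ + n ≤ u + b.card) := by
  have hc : bᶜ.card + b.card = n := by
    rw [← hn]; exact Finset.card_compl_add_card b
  constructor
  · intro h u hu _
    by_cases hlt : t₁ ≤ bᶜ.card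
    · have h0 := h bᶜ hlt
      have he : bᶜ ∩ b = ∅ := by ext x; simp
      rw [he, Finset.card_empty] at h0
      omega
    · obtain ⟨X, hX, hXc⟩ := Finset.exists_superset_card_eq (s := bᶜ) (n := t₁)
        (by omega) (by omega)
      have h1 := h X hXc.ge
      have he : X ∩ b = X \ bᶜ := by ext x; simp
      rw [he] at h1
      have h2 := Finset.card_sdiff_add_card_eq_card hX
      omega
  · intro h X hX
    have h1 := h X.card hX (by rw [← hn]; exact Finset.card_le_univ X)
    have h2 := Finset.card_union_add_card_inter X b
    have h3 := Finset.card_le_univ (X ∪ b)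
    omega
end
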